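/- arXiv:2005.04911 — 4 statements merged into one kernel-verified Lean document; each statement's English description precedes it below -/
import Mathlib

section
/- For every q with 1 ≤ q < ∞ and a standard exponential random variable E, Cov(E, |E − 1|^q) = (q + 1) E[|E − 1|^q] − 1. -/
open MeasureTheory ProbabilityTheory Filter Topology Real

lemma integral_expMeasure_one (f : ℝ → ℝ) :
    ∫ x, f x ∂(expMeasure 1) = ∫ x in Set.Ioi (0 : ℝ), f x * exp (-x) := by
  have h : expMeasure 1 = volume.withDensity (exponentialPDF 1) := rfl
  have hm : Measurable (exponentialPDF 1) :=
    (measurable_exponentialPDFReal 1).ennreal_ofReal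
  rw [h, integral_withDensity_eq_integral_toReal_smul hm
    (ae_of_all _ fun x ↦ ENNReal.ofReal_lt_top), ← integral_Ici_eq_integral_Ioi,
    ← integral_indicator measurableSet_Ici]
  congr 1
  ext x
  by_cases hx : 0 ≤ x
  · rw [exponentialPDF_of_nonneg hx, Set.indicator_of_mem (Set.mem_Ici.2 hx),
      ENNReal.toReal_ofReal (by positivity)]
    simp [mul_comm]
  · rw [exponentialPDF_of_neg (not_le.1 hx), Set.indicator_of_notMem (by simpa using hx)]
    simp

lemma hasDerivAt_self_mul_abs_rpow {q : ℝ} (hq : 0 < q) (y : ℝ) :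
    HasDerivAt (fun y : ℝ ↦ y * |y| ^ q) ((q + 1) * |y| ^ q) y := by
  rcases eq_or_ne y 0 with rfl | hy
  · rw [hasDerivAt_iff_tendsto_slope_zero]
    have hc : Continuous fun t : ℝ ↦ |t| ^ q := continuous_abs.rpow_const fun _ ↦ Or.inr hq.le
    have h0 := (hc.tendsto 0).mono_left (nhdsWithin_le_nhds (s := {0}ᶜ))
    simp only [abs_zero, zero_rpow hq.ne', mul_zero] at h0 ⊢
    refine h0.congr' ?_
    filter_upwards [self_mem_nhdsWithin] with t ht
    have ht : t ≠ 0 := ht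
    simp [ht]
  · have h := (hasDerivAt_id y).mul
      ((hasDerivAt_abs hy).rpow_const (p := q) (Or.inl (abs_ne_zero.2 hy)))
    refine h.congr_deriv ?_
    have hs : y * (SignType.sign y : ℝ) = |y| := by simp
    have hp : |y| * |y| ^ (q - 1) = |y| ^ q := by
      rw [mul_comm, ← rpow_add_one (abs_ne_zero.2 hy), sub_add_cancel]
    simp only [id]
    linear_combination (q * |y| ^ (q - 1)) * hs + q * hp

lemma abs_sub_one_rpow_le {q x : ℝ} (hq : 0 ≤ q) (hx : 0 ≤ x) : |x - 1| ^ q ≤ x ^ q + 1 := by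
  rcases le_total x 1 with h | h
  · have : |x - 1| ^ q ≤ 1 := rpow_le_one (abs_nonneg _) (abs_le.2 ⟨by linarith, by linarith⟩) hq
    linarith [rpow_nonneg hx q]
  · have : |x - 1| ^ q ≤ x ^ q :=
      rpow_le_rpow (abs_nonneg _) (abs_le.2 ⟨by linarith, by linarith⟩) hq
    linarith

lemma integrableOn_pow_mul_abs_sub_one_rpow_mul_exp_neg {q : ℝ} (hq : 0 ≤ q) (k : ℕ) :
    IntegrableOn (fun x : ℝ ↦ x ^ k * |x - 1| ^ q * exp (-x)) (Set.Ioi 0) := by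
  have h1 := GammaIntegral_convergent (s := k + q + 1) (by positivity)
  have h2 := GammaIntegral_convergent (s := k + 1) (by positivity)
  refine (h1.add h2).mono' (Measurable.aestronglyMeasurable (by fun_prop)) ?_
  filter_upwards [ae_restrict_mem measurableSet_Ioi] with x hx
  have hx : 0 < x := hx
  rw [norm_of_nonneg (by positivity)]
  simp only [Pi.add_apply, add_sub_cancel_right, rpow_add hx, rpow_natCast]
  calc x ^ k * |x - 1| ^ q * exp (-x) ≤ x ^ k * (x ^ q + 1) * exp (-x) := by
        gcongr; exact abs_sub_one_rpow_le hq hx.le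
    _ = _ := by ring

lemma tendsto_sub_one_mul_abs_rpow_mul_exp_neg {q : ℝ} (hq : 0 ≤ q) :
    Tendsto (fun x : ℝ ↦ (x - 1) * |x - 1| ^ q * exp (-x)) atTop (𝓝 0) := by
  have h := tendsto_rpow_mul_exp_neg_mul_atTop_nhds_zero (q + 1) 1 one_pos
  refine squeeze_zero' ?_ ?_ h
  · filter_upwards [eventually_ge_atTop 1] with x hx
    have : 0 ≤ x - 1 := by linarith
    positivity
  · filter_upwards [eventually_ge_atTop 1] with x hx
    have h0 : 0 ≤ x - 1 := by linarith
    rw [rpow_add_one (by positivity), abs_of_nonneg h0, neg_one_mul, mul_comm (x ^ q)]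
    gcongr <;> linarith

lemma integral_self_mul_abs_sub_one_rpow_mul_exp_neg {q : ℝ} (hq : 0 < q) :
    ∫ x in Set.Ioi (0 : ℝ), x * |x - 1| ^ q * exp (-x) =
      (q + 2) * (∫ x in Set.Ioi (0 : ℝ), |x - 1| ^ q * exp (-x)) - 1 := by
  have i0 := integrableOn_pow_mul_abs_sub_one_rpow_mul_exp_neg hq.le 0
  have i1 := integrableOn_pow_mul_abs_sub_one_rpow_mul_exp_neg hq.le 1
  simp only [pow_zero, one_mul, pow_one] at i0 i1
  have hd (x : ℝ) : HasDerivAt (fun x : ℝ ↦ (x - 1) * |x - 1| ^ q * exp (-x))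
      ((q + 2) * (|x - 1| ^ q * exp (-x)) - x * |x - 1| ^ q * exp (-x)) x := by
    have h := ((hasDerivAt_self_mul_abs_rpow hq (x - 1)).comp x
      ((hasDerivAt_id x).sub_const 1)).mul (hasDerivAt_neg x).exp
    refine h.congr_deriv ?_
    simp only [Function.comp_apply, id]
    ring
  have h := integral_Ioi_of_hasDerivAt_of_tendsto' (a := 0) (fun x _ ↦ hd x)
    ((i0.const_mul (q + 2)).sub i1) (tendsto_sub_one_mul_abs_rpow_mul_exp_neg hq.le)
  rw [integral_sub (i0.const_mul (q + 2)) i1, integral_const_mul] at h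
  norm_num at h
  linarith

lemma integral_id_expMeasure_one : ∫ x, x ∂(expMeasure 1) = 1 := by
  have h := Gamma_eq_integral (s := 2) two_pos
  rw [Gamma_two] at h
  rw [integral_expMeasure_one, h]
  refine setIntegral_congr_fun measurableSet_Ioi fun x _ ↦ ?_
  norm_num [mul_comm]

/-- **Covariance identity for the exponential distribution.**
For a standard exponential random variable `E` and `1 ≤ q < ∞`,
`Cov(E, |E - 1|^q) = (q + 1) 𝔼|E - 1|^q - 1`, where `Cov(X, Y) = 𝔼[XY] - 𝔼[X]𝔼[Y]`. -/
theorem cov_exponential_abs_rpow (q : ℝ) (hq : 1 ≤ q) :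
    (∫ x, x * |x - 1| ^ q ∂(expMeasure 1)) -
        (∫ x, x ∂(expMeasure 1)) * ∫ x, |x - 1| ^ q ∂(expMeasure 1) =
      (q + 1) * (∫ x, |x - 1| ^ q ∂(expMeasure 1)) - 1 := by
  rw [integral_id_expMeasure_one, integral_expMeasure_one, integral_expMeasure_one,
    integral_self_mul_abs_sub_one_rpow_mul_exp_neg (by linarith)]
  ring
end

section
/- Let 1 ≤ p < ∞ and for each n let Z_n be uniformly distributed in the ℓ_p^n unit ball 𝔹_p^n = {x ∈ ℝ^n : ‖x‖_p ≤ 1}. Then the sequence X_n := (n/(p log n))^{1/p} ‖Z_n‖_∞ satisfies a large deviations principle with speed log n and rate function I(z) = z^p − 1 for z ≥ 1 and I(z) = +∞ for z < 1; that is, for every Borel set A ⊆ ℝ, −inf_{z ∈ A°} I(z) ≤ liminf_{n→∞} (log n)^{−1} log P[X_n ∈ A] and limsup_{n→∞} (log n)^{−1} log P[X_n ∈ A] ≤ −inf_{z ∈ closure(A)} I(z). -/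
open MeasureTheory ProbabilityTheory Filter Topology Real

/-- The unit ball of `ℓ_p^n`. -/
def lpBall (p : ℝ) (n : ℕ) : Set (Fin n → ℝ) :=
  {x | (∑ i, |x i| ^ p) ^ (1 / p) ≤ 1}

/-- The rate function `I(z) = z^p - 1` for `z ≥ 1` and `I(z) = +∞` for `z < 1`. -/
noncomputable def lpRate (p : ℝ) (z : ℝ) : EReal :=
  if 1 ≤ z then ((z ^ p - 1 : ℝ) : EReal) else ⊤

/-- The set of points of `ℝ^n` whose `p`-th power sum is at most `R`. -/
def powerSumBall (p R : ℝ) (n : ℕ) : Set (Fin n → ℝ) :=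
  {x | ∑ i, |x i| ^ p ≤ R}

lemma lpBall_eq_powerSumBall {p : ℝ} (hp : 1 ≤ p) (n : ℕ) :
    lpBall p n = powerSumBall p 1 n := by
  ext x
  have h0 : 0 ≤ ∑ i, |x i| ^ p := Finset.sum_nonneg fun i _ => by positivity
  simp only [lpBall, powerSumBall, Set.mem_ofPred_eq]
  have h := Real.rpow_le_rpow_iff h0 zero_le_one (z := 1 / p) (by positivity)
  rwa [Real.one_rpow] at h

lemma measurableSet_powerSumBall (p R : ℝ) (n : ℕ) :
    MeasurableSet (powerSumBall p R n) := by
  unfold powerSumBall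
  exact measurableSet_le (by fun_prop) measurable_const

lemma measurableSet_exists_le_abs (n : ℕ) (t : ℝ) :
    MeasurableSet {x : Fin n → ℝ | ∃ j, t ≤ |x j|} := by
  rw [Set.ofPred_exists]
  exact MeasurableSet.iUnion fun j => measurableSet_le measurable_const (by fun_prop)

lemma measurableSet_forall_abs_le (n : ℕ) (t : ℝ) :
    MeasurableSet {x : Fin n → ℝ | ∀ j, |x j| ≤ t} := by
  rw [Set.ofPred_forall]
  exact MeasurableSet.iInter fun j => measurableSet_le (by fun_prop) measurable_const

lemma powerSumBall_of_neg {p R : ℝ} (hR : R < 0) (n : ℕ) : powerSumBall p R n = ∅ := by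
  ext x
  have h0 : 0 ≤ ∑ i, |x i| ^ p := Finset.sum_nonneg fun i _ => by positivity
  simp only [powerSumBall, Set.mem_ofPred_eq, Set.mem_empty_iff_false, iff_false, not_le]
  linarith

lemma volume_powerSumBall {p R : ℝ} (hp : 1 ≤ p) (hR : 0 ≤ R) {n : ℕ} (hn : 1 ≤ n) :
    volume (powerSumBall p R n) = ENNReal.ofReal
      (R ^ (n / p) * ((2 * Gamma (1 / p + 1)) ^ n / Gamma (n / p + 1))) := by
  have : Nonempty (Fin n) := ⟨⟨0, hn⟩⟩
  have h := MeasureTheory.volume_sum_rpow_le (Fin n) hp (R ^ (1 / p))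
  have hset : powerSumBall p R n =
      {x : Fin n → ℝ | (∑ i, |x i| ^ p) ^ (1 / p) ≤ R ^ (1 / p)} := by
    ext x
    have h0 : 0 ≤ ∑ i, |x i| ^ p := Finset.sum_nonneg fun i _ => by positivity
    simp only [powerSumBall, Set.mem_ofPred_eq]
    rw [Real.rpow_le_rpow_iff h0 hR (by positivity)]
  rw [hset, h, Fintype.card_fin, ← ENNReal.ofReal_pow (by positivity),
    ← ENNReal.ofReal_mul (by positivity), ← Real.rpow_natCast, ← Real.rpow_mul hR]
  congr 3
  ring

lemma volume_powerSumBall_lt_top {p R : ℝ} (hp : 1 ≤ p) {n : ℕ} (hn : 1 ≤ n) :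
    volume (powerSumBall p R n) < ⊤ := by
  rcases lt_or_ge R 0 with h | h
  · simp [powerSumBall_of_neg h]
  · rw [volume_powerSumBall hp h hn]
    exact ENNReal.ofReal_lt_top

lemma volume_real_powerSumBall_one {p : ℝ} (hp : 1 ≤ p) {n : ℕ} (hn : 1 ≤ n) :
    volume.real (powerSumBall p 1 n) = (2 * Gamma (1 / p + 1)) ^ n / Gamma (n / p + 1) := by
  have h1 : 0 < Gamma (1 / p + 1) := Real.Gamma_pos_of_pos (by positivity)
  have h2 : 0 < Gamma (n / p + 1) := Real.Gamma_pos_of_pos (by positivity)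
  rw [Measure.real, volume_powerSumBall hp zero_le_one hn, ENNReal.toReal_ofReal (by positivity)]
  simp

lemma volume_real_powerSumBall_one_pos {p : ℝ} (hp : 1 ≤ p) {n : ℕ} (hn : 1 ≤ n) :
    0 < volume.real (powerSumBall p 1 n) := by
  have h1 : 0 < Gamma (1 / p + 1) := Real.Gamma_pos_of_pos (by positivity)
  have h2 : 0 < Gamma (n / p + 1) := Real.Gamma_pos_of_pos (by positivity)
  rw [volume_real_powerSumBall_one hp hn]
  positivity

lemma volume_real_powerSumBall {p R : ℝ} (hp : 1 ≤ p) (hR : 0 ≤ R) {n : ℕ} (hn : 1 ≤ n) :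
    volume.real (powerSumBall p R n) = R ^ (n / p) * volume.real (powerSumBall p 1 n) := by
  have h1 : 0 < Gamma (1 / p + 1) := Real.Gamma_pos_of_pos (by positivity)
  have h2 : 0 < Gamma (n / p + 1) := Real.Gamma_pos_of_pos (by positivity)
  rw [volume_real_powerSumBall_one hp hn, Measure.real, volume_powerSumBall hp hR hn,
    ENNReal.toReal_ofReal (by positivity)]

lemma rpow_sub_add_rpow_le {p s t : ℝ} (hp : 1 ≤ p) (ht : 0 ≤ t) (hts : t ≤ s) :
    (s - t) ^ p + t ^ p ≤ s ^ p := by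
  have h := NNReal.add_rpow_le_rpow_add ⟨s - t, by linarith⟩ ⟨t, ht⟩ hp
  have h' : ((⟨s - t, by linarith⟩ : NNReal) ^ p + (⟨t, ht⟩ : NNReal) ^ p : ℝ) ≤
      ((⟨s - t, by linarith⟩ : NNReal) + (⟨t, ht⟩ : NNReal) : ℝ) ^ p := by exact_mod_cast h
  simpa using h'

/-- Shifting the `j`-th coordinate by `t` towards `0` decreases the power sum by at least `t ^ p`
when that coordinate exceeds `t`. -/
lemma sum_shift_le {p t : ℝ} (hp : 1 ≤ p) (ht : 0 ≤ t) {n : ℕ} (x : Fin n → ℝ) (j : Fin n)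
    (u : ℝ) (hu : |x j + u| = |x j| - t) (htx : t ≤ |x j|) :
    ∑ i, |(x + Pi.single j u : Fin n → ℝ) i| ^ p + t ^ p ≤ ∑ i, |x i| ^ p := by
  rw [← Finset.add_sum_erase _ _ (Finset.mem_univ j),
    ← Finset.add_sum_erase (a := j) _ (fun i => |x i| ^ p) (Finset.mem_univ j)]
  have h1 : ∑ i ∈ Finset.univ.erase j, |(x + Pi.single j u : Fin n → ℝ) i| ^ p =
      ∑ i ∈ Finset.univ.erase j, |x i| ^ p := by
    refine Finset.sum_congr rfl fun i hi => ?_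
    simp [Finset.ne_of_mem_erase hi]
  have h2 := rpow_sub_add_rpow_le hp ht htx
  rw [h1]
  simp only [Pi.add_apply, Pi.single_eq_same, hu]
  linarith

lemma volume_preimage_add_const {n : ℕ} (v : Fin n → ℝ) (B : Set (Fin n → ℝ)) :
    volume ((fun x : Fin n → ℝ => x + v) ⁻¹' B) = volume B :=
  measure_preimage_add_right volume v B

lemma volume_real_coord_tail_le {p R t : ℝ} (hp : 1 ≤ p) (ht : 0 ≤ t) {n : ℕ} (hn : 1 ≤ n)
    (j : Fin n) :
    volume.real {x ∈ powerSumBall p R n | t ≤ |x j|} ≤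
      2 * volume.real (powerSumBall p (R - t ^ p) n) := by
  set B := powerSumBall p (R - t ^ p) n with hB
  have hfin : volume B ≠ ⊤ := (volume_powerSumBall_lt_top hp hn).ne
  obtain ⟨S, hS⟩ : ∃ S : ℝ → Set (Fin n → ℝ),
      ∀ u, S u = (fun x : Fin n → ℝ => x + Pi.single j u) ⁻¹' B := ⟨_, fun _ => rfl⟩
  have hvol (u : ℝ) : volume (S u) = volume B := by
    rw [hS, volume_preimage_add_const]
  have hmem (x : Fin n → ℝ) (hx : x ∈ powerSumBall p R n) (hxt : t ≤ |x j|) (u : ℝ)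
      (hu : |x j + u| = |x j| - t) : x ∈ S u := by
    have h := sum_shift_le hp ht x j u hu hxt
    rw [hS, Set.mem_preimage, hB]
    simp only [powerSumBall, Set.mem_ofPred_eq] at hx ⊢
    linarith
  have hsub : {x ∈ powerSumBall p R n | t ≤ |x j|} ⊆ S (-t) ∪ S t := by
    rintro x ⟨hx, hxt⟩
    rcases le_total 0 (x j) with h0 | h0
    · refine Or.inl (hmem x hx hxt _ ?_)
      rw [abs_of_nonneg h0] at hxt ⊢
      rw [abs_of_nonneg] <;> linarith
    · refine Or.inr (hmem x hx hxt _ ?_)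
      rw [abs_of_nonpos h0] at hxt ⊢
      rw [abs_of_nonpos] <;> linarith
  calc _ ≤ volume.real (S (-t) ∪ S t) := measureReal_mono hsub
        (measure_union_ne_top (by rwa [hvol]) (by rwa [hvol]))
    _ ≤ volume.real (S (-t)) + volume.real (S t) := measureReal_union_le _ _
    _ = _ := by simp only [Measure.real, hvol]; ring

lemma volume_real_powerSumBall_sub_le {p R y : ℝ} (hp : 1 ≤ p) (hR : 0 ≤ R) (hR1 : R ≤ 1)
    (hy : 0 ≤ y) {n : ℕ} (hn : 1 ≤ n) :
    volume.real (powerSumBall p (R - y) n) ≤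
      exp (-(n * y / p)) * volume.real (powerSumBall p R n) := by
  rcases lt_or_ge (R - y) 0 with h | h
  · rw [powerSumBall_of_neg h, measureReal_empty]
    positivity
  · rw [volume_real_powerSumBall hp h hn, volume_real_powerSumBall hp hR hn, ← mul_assoc]
    refine mul_le_mul_of_nonneg_right ?_ measureReal_nonneg
    have h1 : R - y ≤ R * exp (-y) := by
      nlinarith [Real.add_one_le_exp (-y), mul_le_mul_of_nonneg_right hR1 hy]
    calc (R - y) ^ (n / p) ≤ (R * exp (-y)) ^ (n / p) :=
          Real.rpow_le_rpow h h1 (by positivity)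
      _ = _ := by
          rw [Real.mul_rpow hR (exp_pos _).le, ← Real.exp_mul, mul_comm]
          congr 2
          ring

/-- Tail bound for the sup norm on a ball, by a union bound over coordinates. -/
lemma volume_real_exists_tail_le {p R t : ℝ} (hp : 1 ≤ p) (hR : 0 ≤ R) (hR1 : R ≤ 1)
    (ht : 0 ≤ t) {n : ℕ} (hn : 1 ≤ n) :
    volume.real {x ∈ powerSumBall p R n | ∃ j, t ≤ |x j|} ≤
      2 * n * exp (-(n * t ^ p / p)) * volume.real (powerSumBall p R n) := by
  have hset : {x ∈ powerSumBall p R n | ∃ j, t ≤ |x j|} =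
      ⋃ j, {x ∈ powerSumBall p R n | t ≤ |x j|} := by
    ext x; simp
  rw [hset]
  calc _ ≤ ∑ j : Fin n, volume.real {x ∈ powerSumBall p R n | t ≤ |x j|} :=
        measureReal_iUnion_fintype_le _
    _ ≤ ∑ j : Fin n, 2 * (exp (-(n * t ^ p / p)) * volume.real (powerSumBall p R n)) := by
        refine Finset.sum_le_sum fun j _ => (volume_real_coord_tail_le hp ht hn j).trans ?_
        gcongr
        exact volume_real_powerSumBall_sub_le hp hR hR1 (by positivity) hn
    _ = _ := by simp; ring

lemma volume_real_prod_coord {n : ℕ} (i : Fin (n + 1)) (I : Set ℝ) (B : Set (Fin n → ℝ)) :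
    volume.real {x : Fin (n + 1) → ℝ | x i ∈ I ∧ (fun j => x (i.succAbove j)) ∈ B} =
      volume.real I * volume.real B := by
  have h := (volume_preserving_piFinSuccAbove (fun _ : Fin (n + 1) => ℝ) i).measure_preimage_equiv
    (I ×ˢ B)
  rw [Measure.volume_eq_prod, Measure.prod_prod] at h
  simp only [Measure.real, ← ENNReal.toReal_mul, ← h]
  rfl

/-- Comparison of the volumes of balls in consecutive dimensions. -/
lemma volume_real_powerSumBall_succ_le {p t : ℝ} (hp : 1 ≤ p) (ht : 0 ≤ t) {n : ℕ} (hn : 1 ≤ n) :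
    volume.real (powerSumBall p 1 (n + 1)) ≤ 2 * t * volume.real (powerSumBall p 1 n) +
      2 * exp (-((n + 1 : ℕ) * t ^ p / p)) * volume.real (powerSumBall p 1 (n + 1)) := by
  have hn' : 1 ≤ n + 1 := by omega
  have hsub : powerSumBall p 1 (n + 1) ⊆
      {x : Fin (n + 1) → ℝ | x 0 ∈ Set.Icc (-t) t ∧
        (fun j => x ((0 : Fin (n + 1)).succAbove j)) ∈ powerSumBall p 1 n} ∪
      {x ∈ powerSumBall p 1 (n + 1) | t ≤ |x 0|} := by
    intro x hx
    rcases le_total t |x 0| with h | h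
    · exact Or.inr ⟨hx, h⟩
    · refine Or.inl ⟨abs_le.mp h, ?_⟩
      simp only [powerSumBall, Set.mem_ofPred_eq, Fin.sum_univ_succ, Fin.succAbove_zero] at hx ⊢
      have : 0 ≤ |x 0| ^ p := by positivity
      linarith
  have h1 : volume.real {x : Fin (n + 1) → ℝ | x 0 ∈ Set.Icc (-t) t ∧
        (fun j => x ((0 : Fin (n + 1)).succAbove j)) ∈ powerSumBall p 1 n} =
      2 * t * volume.real (powerSumBall p 1 n) := by
    rw [volume_real_prod_coord, Real.volume_real_Icc_of_le (by linarith)]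
    ring
  have h2 := (volume_real_coord_tail_le (R := 1) hp ht hn' 0).trans
    (mul_le_mul_of_nonneg_left (volume_real_powerSumBall_sub_le (y := t ^ p) hp zero_le_one le_rfl
      (by positivity) hn') zero_le_two)
  have hfin1 : volume {x : Fin (n + 1) → ℝ | x 0 ∈ Set.Icc (-t) t ∧
        (fun j => x ((0 : Fin (n + 1)).succAbove j)) ∈ powerSumBall p 1 n} ≠ ⊤ := by
    have h := (volume_preserving_piFinSuccAbove (fun _ : Fin (n + 1) => ℝ)
      0).measure_preimage_equiv (Set.Icc (-t) t ×ˢ powerSumBall p 1 n)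
    rw [Measure.volume_eq_prod, Measure.prod_prod] at h
    refine ne_of_eq_of_ne h (ENNReal.mul_ne_top (by simp) (volume_powerSumBall_lt_top hp hn).ne)
  have hfin2 : volume {x ∈ powerSumBall p 1 (n + 1) | t ≤ |x 0|} ≠ ⊤ :=
    measure_ne_top_of_subset (fun x hx => hx.1) (volume_powerSumBall_lt_top hp hn').ne
  have h3 := (measureReal_mono hsub (measure_union_ne_top hfin1 hfin2)).trans
    (measureReal_union_le _ _)
  rw [h1] at h3
  linarith

/-- Lower bound for the volume of the part of the unit ball on which the sup norm lies in
`[t, t']`, obtained from disjoint product sets on which exactly one coordinate is large. -/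
lemma le_volume_real_sup_between {p t t' : ℝ} (hp : 1 ≤ p) (ht : 0 ≤ t) (htt : t ≤ t')
    (ht' : t' ^ p ≤ 1) {n : ℕ} (hn : 1 ≤ n) :
    (n + 1) * ((t' - t) * ((1 - 2 * n * exp (-(n * t ^ p / p))) *
      ((1 - t' ^ p) ^ (n / p) * volume.real (powerSumBall p 1 n)))) ≤
    volume.real {x ∈ powerSumBall p 1 (n + 1) | (∃ j, t ≤ |x j|) ∧ ∀ j, |x j| ≤ t'} := by
  have hn' : 1 ≤ n + 1 := by omega
  have hp0 : 0 < p := by linarith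
  have hR : 0 ≤ 1 - t' ^ p := by linarith
  have hR1 : 1 - t' ^ p ≤ 1 := by
    have : 0 ≤ t' ^ p := Real.rpow_nonneg (ht.trans htt) p
    linarith
  set B := powerSumBall p (1 - t' ^ p) n with hB
  set T := {x ∈ B | ∃ j, t ≤ |x j|} with hT
  have hTB : T ⊆ B := fun x hx => hx.1
  have hBfin : volume B ≠ ⊤ := (volume_powerSumBall_lt_top hp hn).ne
  have hTm : MeasurableSet T :=
    (measurableSet_powerSumBall _ _ _).inter (measurableSet_exists_le_abs n t)
  have hGm : MeasurableSet (B \ T) := (measurableSet_powerSumBall _ _ _).diff hTm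
  have hG : (1 - 2 * n * exp (-(n * t ^ p / p))) *
      ((1 - t' ^ p) ^ (n / p) * volume.real (powerSumBall p 1 n)) ≤ volume.real (B \ T) := by
    rw [measureReal_sdiff hTB hTm hBfin,
      ← volume_real_powerSumBall hp hR hn]
    have := volume_real_exists_tail_le (t := t) hp hR hR1 ht hn
    rw [← hB, ← hT] at *
    linarith
  obtain ⟨D, hD⟩ : ∃ D : Fin (n + 1) → Set (Fin (n + 1) → ℝ), ∀ i, D i =
      {x | x i ∈ Set.Icc t t' ∧ (fun j => x (i.succAbove j)) ∈ B \ T} := ⟨_, fun _ => rfl⟩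
  have hDm (i) : MeasurableSet (D i) := by
    rw [hD]
    exact (measurableSet_Icc.preimage (measurable_pi_apply i)).inter
      (hGm.preimage (by fun_prop))
  have hDdisj : Pairwise (Function.onFun Disjoint D) := by
    intro i k hik
    refine Set.disjoint_left.mpr fun x hxi hxk => ?_
    rw [hD] at hxi hxk
    obtain ⟨j, hj⟩ := Fin.exists_succAbove_eq hik
    refine hxk.2.2 ⟨hxk.2.1, j, ?_⟩
    simp only [hj]
    exact hxi.1.1.trans (le_abs_self _)
  have hsub : (⋃ i, D i) ⊆
      {x ∈ powerSumBall p 1 (n + 1) | (∃ j, t ≤ |x j|) ∧ ∀ j, |x j| ≤ t'} := by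
    refine Set.iUnion_subset fun i x hx => ?_
    rw [hD] at hx
    obtain ⟨⟨h1, h2⟩, h3, h4⟩ := hx
    have hxi : |x i| = x i := abs_of_nonneg (ht.trans h1)
    refine ⟨?_, ⟨i, by rwa [hxi]⟩, fun j => ?_⟩
    · simp only [powerSumBall, Set.mem_ofPred_eq, hB, Fin.sum_univ_succAbove _ i] at h3 ⊢
      have : |x i| ^ p ≤ t' ^ p := Real.rpow_le_rpow (abs_nonneg _) (by rwa [hxi]) hp0.le
      linarith
    · rcases eq_or_ne j i with rfl | hji
      · rwa [hxi]
      · obtain ⟨k, rfl⟩ := Fin.exists_succAbove_eq hji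
        by_contra! hlt
        exact h4 ⟨h3, k, htt.trans hlt.le⟩
  have hfin : volume {x ∈ powerSumBall p 1 (n + 1) | (∃ j, t ≤ |x j|) ∧ ∀ j, |x j| ≤ t'} ≠ ⊤ :=
    measure_ne_top_of_subset (fun x hx => hx.1) (volume_powerSumBall_lt_top hp hn').ne
  have hDfin (i) : volume (D i) ≠ ⊤ :=
    measure_ne_top_of_subset ((Set.subset_iUnion D i).trans hsub) hfin
  have hDvol (i) : volume.real (D i) = (t' - t) * volume.real (B \ T) := by
    rw [hD, volume_real_prod_coord, Real.volume_real_Icc_of_le htt]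
  refine le_trans ?_ (measureReal_mono hsub hfin)
  have hU : volume.real (⋃ i, D i) = ∑ i, volume.real (D i) := by
    rw [Measure.real, measure_iUnion hDdisj hDm, tsum_fintype,
      ENNReal.toReal_sum fun i _ => hDfin i]
    rfl
  rw [hU]
  simp only [hDvol, Finset.sum_const, Finset.card_univ, Fintype.card_fin, nsmul_eq_mul]
  push_cast
  have : 0 ≤ t' - t := by linarith
  gcongr

/-- A weak form of Stirling's upper bound for the Gamma function. -/
lemma Gamma_add_one_le {s : ℝ} (hs : 0 < s) :
    Gamma (s + 1) ≤ (s + 1) * exp (1 - s) * s ^ s := by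
  have hs1 : 0 < s + 1 := by linarith
  have hr : 0 < (s + 1)⁻¹ := by positivity
  have hint : IntegrableOn (fun x : ℝ => exp (1 - s) * s ^ s * exp (-(s + 1)⁻¹ * x))
      (Set.Ioi 0) := (integrableOn_exp_mul_Ioi (by linarith) 0).const_mul _
  have hbound : ∀ x ∈ Set.Ioi (0 : ℝ), exp (-x) * x ^ (s + 1 - 1) ≤
      exp (1 - s) * s ^ s * exp (-(s + 1)⁻¹ * x) := by
    intro x hx
    have hx : 0 < x := hx
    rw [add_sub_cancel_right, Real.rpow_def_of_pos hx, Real.rpow_def_of_pos hs, ← Real.exp_add,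
      ← Real.exp_add, ← Real.exp_add, Real.exp_le_exp]
    have h1 : log (x / (s + 1)) ≤ x / (s + 1) - 1 := Real.log_le_sub_one_of_pos (by positivity)
    have h2 : log ((s + 1) / s) ≤ (s + 1) / s - 1 := Real.log_le_sub_one_of_pos (by positivity)
    rw [Real.log_div hx.ne' hs1.ne'] at h1
    rw [Real.log_div hs1.ne' hs.ne'] at h2
    have h3 : s * (log x - log s) ≤ s * (x / (s + 1) - 1 + ((s + 1) / s - 1)) := by
      gcongr; linarith
    have h4 : s * (x / (s + 1) - 1 + ((s + 1) / s - 1)) = x - (s + 1)⁻¹ * x - s + 1 := by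
      field_simp
      ring
    nlinarith
  rw [Real.Gamma_eq_integral hs1]
  refine (setIntegral_mono_on (Real.GammaIntegral_convergent hs1) hint measurableSet_Ioi
    hbound).trans (le_of_eq ?_)
  rw [integral_const_mul, integral_exp_mul_Ioi (by linarith)]
  simp
  ring

lemma integral_exp_neg_mul_abs_rpow {p s : ℝ} (hp : 0 < p) (hs : 0 < s) :
    ∫ x : ℝ, exp (-s * |x| ^ p) = s ^ (-1 / p) * (2 * Gamma (1 / p + 1)) := by
  rw [integral_comp_abs (f := fun x => exp (-s * x ^ p)), integral_exp_neg_mul_rpow hp hs]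
  ring

lemma integrable_exp_neg_mul_abs_rpow {p s : ℝ} (hp : 0 < p) (hs : 0 < s) :
    Integrable fun x : ℝ => exp (-s * |x| ^ p) := by
  refine not_imp_comm.mp integral_undef ?_
  have : 0 < Gamma (1 / p + 1) := Real.Gamma_pos_of_pos (by positivity)
  rw [integral_exp_neg_mul_abs_rpow hp hs]
  positivity

lemma setIntegral_exp_neg_mul_abs_rpow_le {p s t t' : ℝ} (hp : 0 < p) (hs : 0 < s) (ht : 0 ≤ t)
    (htt : t ≤ t') :
    ∫ x in Set.Icc (-t) t, exp (-s * |x| ^ p) ≤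
      s ^ (-1 / p) * (2 * Gamma (1 / p + 1)) - (t' - t) * exp (-s * t' ^ p) := by
  have hI := integrable_exp_neg_mul_abs_rpow hp hs
  have h1 : (∫ x in Set.Icc (-t) t, exp (-s * |x| ^ p)) + ∫ x in Set.Ioc t t', exp (-s * |x| ^ p) ≤
      ∫ x : ℝ, exp (-s * |x| ^ p) := by
    rw [← setIntegral_union (Set.disjoint_left.mpr fun x hx hx' => hx'.1.not_ge hx.2)
      measurableSet_Ioc hI.integrableOn hI.integrableOn]
    exact setIntegral_le_integral hI (ae_of_all _ fun x => (exp_pos _).le)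
  have h2 : (t' - t) * exp (-s * t' ^ p) ≤ ∫ x in Set.Ioc t t', exp (-s * |x| ^ p) := by
    have h3 : ∫ x in Set.Ioc t t', exp (-s * t' ^ p) = (t' - t) * exp (-s * t' ^ p) := by
      rw [setIntegral_const, Real.volume_real_Ioc_of_le htt, smul_eq_mul]
    rw [← h3]
    refine setIntegral_mono_on (by simp) hI.integrableOn measurableSet_Ioc fun x hx => ?_
    have hx0 : 0 ≤ x := ht.trans hx.1.le
    have : |x| ^ p ≤ t' ^ p := Real.rpow_le_rpow (abs_nonneg _)
      (by rw [abs_of_nonneg hx0]; exact hx.2) hp.le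
    rw [Real.exp_le_exp]
    nlinarith
  rw [integral_exp_neg_mul_abs_rpow hp hs] at h1
  linarith

/-- Exponential Chebyshev bound for the volume of the intersection of the unit ball with a cube. -/
lemma volume_real_inter_cube_le {p s t : ℝ} (hp : 1 ≤ p) (hs : 0 < s) {n : ℕ} (hn : 1 ≤ n) :
    volume.real {x ∈ powerSumBall p 1 n | ∀ j, |x j| ≤ t} ≤
      exp s * (∫ x in Set.Icc (-t) t, exp (-s * |x| ^ p)) ^ n := by
  set S := {x ∈ powerSumBall p 1 n | ∀ j, |x j| ≤ t} with hS
  have hSm : MeasurableSet S :=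
    (measurableSet_powerSumBall _ _ _).inter (measurableSet_forall_abs_le n t)
  have hSfin : volume S ≠ ⊤ :=
    measure_ne_top_of_subset (fun x hx => hx.1) (volume_powerSumBall_lt_top hp hn).ne
  set f : ℝ → ℝ := (Set.Icc (-t) t).indicator fun x => exp (-s * |x| ^ p) with hf
  have hf0 (x : ℝ) : 0 ≤ f x := Set.indicator_nonneg (fun x _ => (exp_pos _).le) x
  have hfI : Integrable f :=
    (integrable_exp_neg_mul_abs_rpow (by linarith) hs).indicator measurableSet_Icc
  have hprod : ∫ x : Fin n → ℝ, ∏ i, f (x i) =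
      (∫ x in Set.Icc (-t) t, exp (-s * |x| ^ p)) ^ n := by
    rw [integral_fintype_prod_volume_eq_pow, Fintype.card_fin, hf,
      integral_indicator measurableSet_Icc]
  have hprodI : Integrable (fun x : Fin n → ℝ => ∏ i, f (x i)) :=
    Integrable.fintype_prod fun _ => hfI
  rw [← hprod, ← integral_const_mul, ← integral_indicator_one hSm]
  refine integral_mono ((integrable_indicator_iff hSm).mpr (integrableOn_const hSfin))
    (hprodI.const_mul _) fun x => ?_
  by_cases hx : x ∈ S
  · have h1 : ∏ i, f (x i) = ∏ i, exp (-s * |x i| ^ p) :=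
      Finset.prod_congr rfl fun i _ => Set.indicator_of_mem (Set.mem_Icc.mpr (abs_le.mp (hx.2 i))) _
    have h2 : ∑ i, |x i| ^ p ≤ 1 := hx.1
    simp only [Set.indicator_of_mem hx, Pi.one_apply]
    rw [h1, ← Real.exp_sum, ← Finset.mul_sum, ← Real.exp_add, Real.one_le_exp_iff]
    nlinarith
  · rw [Set.indicator_of_notMem hx]
    exact mul_nonneg (exp_pos _).le (Finset.prod_nonneg fun i _ => hf0 _)

/-- The fraction of the unit ball lying in a small cube is tiny. -/
lemma volume_real_inter_cube_le_mul {p t t' : ℝ} (hp : 1 ≤ p) (ht : 0 ≤ t) (htt : t ≤ t')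
    {n : ℕ} (hn : 1 ≤ n) :
    volume.real {x ∈ powerSumBall p 1 n | ∀ j, |x j| ≤ t} ≤
      ((n / p + 1) * exp 1) * exp (-(n * ((t' - t) * exp (-(n / p) * t' ^ p) *
        ((n / p) ^ (1 / p) / (2 * Gamma (1 / p + 1)))))) * volume.real (powerSumBall p 1 n) := by
  have hp0 : 0 < p := by linarith
  have hn0 : (0 : ℝ) < n := by exact_mod_cast hn
  set s : ℝ := n / p with hs
  have hs0 : 0 < s := by positivity
  set G := 2 * Gamma (1 / p + 1) with hG
  have hG0 : 0 < G := mul_pos two_pos (Real.Gamma_pos_of_pos (by positivity))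
  have hGs : 0 < Gamma (s + 1) := Real.Gamma_pos_of_pos (by positivity)
  set q := (t' - t) * exp (-s * t' ^ p) * (s ^ (1 / p) / G) with hq
  have hsp : s ^ (-1 / p) * s ^ (1 / p) = 1 := by
    rw [← Real.rpow_add hs0]
    ring_nf
    simp
  have hint : ∫ x in Set.Icc (-t) t, exp (-s * |x| ^ p) ≤ s ^ (-1 / p) * G * exp (-q) := by
    refine (setIntegral_exp_neg_mul_abs_rpow_le hp0 hs0 ht htt).trans ?_
    have h1 : (t' - t) * exp (-s * t' ^ p) = s ^ (-1 / p) * G * q := by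
      have hGG : G * G⁻¹ = 1 := mul_inv_cancel₀ hG0.ne'
      rw [hq, div_eq_mul_inv (s ^ (1 / p))]
      linear_combination (-((t' - t) * exp (-s * t' ^ p))) * hsp -
        (t' - t) * exp (-s * t' ^ p) * (s ^ (-1 / p) * s ^ (1 / p)) * hGG
    have h2 : 1 - q ≤ exp (-q) := by linarith [Real.add_one_le_exp (-q)]
    have h3 : 0 < s ^ (-1 / p) * G := by positivity
    rw [h1]
    nlinarith
  have hint0 : 0 ≤ ∫ x in Set.Icc (-t) t, exp (-s * |x| ^ p) :=
    integral_nonneg fun x => (exp_pos _).le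
  have hpow : (s ^ (-1 / p)) ^ n * s ^ s = 1 := by
    rw [← Real.rpow_natCast, ← Real.rpow_mul hs0.le, ← Real.rpow_add hs0]
    have : -1 / p * n + s = 0 := by rw [hs]; ring
    rw [this, Real.rpow_zero]
  calc _ ≤ exp s * (∫ x in Set.Icc (-t) t, exp (-s * |x| ^ p)) ^ n :=
        volume_real_inter_cube_le hp hs0 hn
    _ ≤ exp s * (s ^ (-1 / p) * G * exp (-q)) ^ n := by gcongr
    _ = exp s * (s ^ (-1 / p)) ^ n * exp (-(n * q)) * Gamma (s + 1) *
        volume.real (powerSumBall p 1 n) := by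
      rw [volume_real_powerSumBall_one hp hn, ← hs, ← hG, mul_pow, mul_pow, ← Real.exp_nat_mul]
      field_simp
    _ ≤ exp s * (s ^ (-1 / p)) ^ n * exp (-(n * q)) * ((s + 1) * exp (1 - s) * s ^ s) *
        volume.real (powerSumBall p 1 n) := by
      gcongr
      exact Gamma_add_one_le hs0
    _ = ((s ^ (-1 / p)) ^ n * s ^ s) * (exp s * exp (1 - s)) * (s + 1) * exp (-(n * q)) *
        volume.real (powerSumBall p 1 n) := by ring
    _ = _ := by
      rw [hpow, ← Real.exp_add]
      ring_nf

/-- The scale `(p log n / n) ^ (1 / p)` at which the sup norm concentrates. -/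
noncomputable def supScale (p : ℝ) (n : ℕ) : ℝ := (p * log n / n) ^ (1 / p)

lemma log_natCast_pos {n : ℕ} (hn : 2 ≤ n) : 0 < log (n : ℝ) :=
  Real.log_pos (by exact_mod_cast hn)

lemma supScale_pos {p : ℝ} (hp : 1 ≤ p) {n : ℕ} (hn : 2 ≤ n) : 0 < supScale p n := by
  have := log_natCast_pos hn
  unfold supScale
  positivity

lemma div_rpow_eq_inv_supScale {p : ℝ} (hp : 1 ≤ p) {n : ℕ} (hn : 2 ≤ n) :
    ((n : ℝ) / (p * log n)) ^ (1 / p) = (supScale p n)⁻¹ := by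
  have := log_natCast_pos hn
  rw [supScale, ← Real.inv_rpow (by positivity), inv_div]

lemma mul_supScale_rpow {p z : ℝ} (hp : 1 ≤ p) (hz : 0 ≤ z) {n : ℕ} (hn : 2 ≤ n) :
    (z * supScale p n) ^ p = z ^ p * (p * log n / n) := by
  have := log_natCast_pos hn
  rw [Real.mul_rpow hz (supScale_pos hp hn).le, supScale, ← Real.rpow_mul (by positivity),
    one_div_mul_cancel (by positivity), Real.rpow_one]

section Probability

variable {Ω : Type*} [MeasureSpace Ω] {p : ℝ}
  {Z : (n : ℕ) → Ω → (Fin n → ℝ)}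

lemma prob_mem_eq (hp : 1 ≤ p) (hZmeas : ∀ n, Measurable (Z n))
    (hZdist : ∀ n : ℕ, Measure.map (Z n) ℙ = (volume : Measure (Fin n → ℝ))[|lpBall p n])
    {n : ℕ} {S : Set (Fin n → ℝ)} (hS : MeasurableSet S) :
    (ℙ : Measure Ω).real {ω | Z n ω ∈ S} =
      volume.real {x ∈ powerSumBall p 1 n | x ∈ S} / volume.real (powerSumBall p 1 n) := by
  have h := map_measureReal_apply (μ := ℙ) (hZmeas n) hS
  rw [hZdist, lpBall_eq_powerSumBall hp, Measure.real,
    cond_apply (measurableSet_powerSumBall p 1 n), ENNReal.toReal_mul, ENNReal.toReal_inv] at h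
  rw [div_eq_inv_mul]
  exact h.symm

lemma prob_exists_tail_le (hp : 1 ≤ p) (hZmeas : ∀ n, Measurable (Z n))
    (hZdist : ∀ n : ℕ, Measure.map (Z n) ℙ = (volume : Measure (Fin n → ℝ))[|lpBall p n])
    {n : ℕ} (hn : 2 ≤ n) {z : ℝ} (hz : 0 ≤ z) :
    (ℙ : Measure Ω).real {ω | ∃ j, z * supScale p n ≤ |Z n ω j|} ≤
      2 * n * exp (-(z ^ p * log n)) := by
  have hS : MeasurableSet {x : Fin n → ℝ | ∃ j, z * supScale p n ≤ |x j|} :=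
    measurableSet_exists_le_abs n _
  have hv := volume_real_powerSumBall_one_pos hp (show 1 ≤ n by omega)
  have hn0 : (0 : ℝ) < n := by positivity
  refine (prob_mem_eq hp hZmeas hZdist hS).trans_le ?_
  rw [div_le_iff₀ hv]
  refine (volume_real_exists_tail_le hp zero_le_one le_rfl
    (mul_nonneg hz (supScale_pos hp hn).le) (by omega)).trans_eq ?_
  rw [mul_supScale_rpow hp hz hn]
  congr 4
  field_simp

lemma prob_forall_le_le (hp : 1 ≤ p) (hZmeas : ∀ n, Measurable (Z n))
    (hZdist : ∀ n : ℕ, Measure.map (Z n) ℙ = (volume : Measure (Fin n → ℝ))[|lpBall p n])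
    {n : ℕ} (hn : 2 ≤ n) {z z' : ℝ} (hz : 0 ≤ z) (hzz : z ≤ z') :
    (ℙ : Measure Ω).real {ω | ∀ j, |Z n ω j| ≤ z * supScale p n} ≤
      (n / p + 1) * exp 1 * exp (-((z' - z) / (2 * Gamma (1 / p + 1)) * (log n) ^ (1 / p) *
        (n * exp (-(z' ^ p * log n))))) := by
  have hS : MeasurableSet {x : Fin n → ℝ | ∀ j, |x j| ≤ z * supScale p n} :=
    measurableSet_forall_abs_le n _
  have hv := volume_real_powerSumBall_one_pos hp (show 1 ≤ n by omega)
  have hn0 : (0 : ℝ) < n := by positivity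
  have hL := log_natCast_pos hn
  have ht0 := supScale_pos hp hn
  refine (prob_mem_eq hp hZmeas hZdist hS).trans_le ?_
  rw [div_le_iff₀ hv]
  refine (volume_real_inter_cube_le_mul hp (mul_nonneg hz ht0.le)
    (mul_le_mul_of_nonneg_right hzz ht0.le) (by omega)).trans_eq ?_
  have h1 : -(n / p) * (z' * supScale p n) ^ p = -(z' ^ p * log n) := by
    rw [mul_supScale_rpow hp (hz.trans hzz) hn]
    field_simp
  have h2 : supScale p n * (n / p) ^ (1 / p) = (log n) ^ (1 / p) := by
    rw [supScale, ← Real.mul_rpow (by positivity) (by positivity)]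
    congr 1
    field_simp
  rw [h1, ← h2]
  congr 4
  ring

lemma le_prob_between (hp : 1 ≤ p) (hZmeas : ∀ n, Measurable (Z n))
    (hZdist : ∀ n : ℕ, Measure.map (Z n) ℙ = (volume : Measure (Fin n → ℝ))[|lpBall p n])
    {n : ℕ} (hn : 4 ≤ n) {a b κ β : ℝ} (ha : 0 ≤ a) (hab : a ≤ b)
    (hκ : κ * n ≤ a ^ p * (n - 1))
    (hκ2 : 4 * exp (-((κ - 1) * log n)) ≤ 1)
    (hx : b ^ p * (p * log n / n) < 1)
    (hβ : b ^ p ≤ β * (1 - b ^ p * (p * log n / n))) :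
    (b - a) / 8 * exp ((1 - β) * log n) ≤ (ℙ : Measure Ω).real
      {ω | (∃ j, a * supScale p n ≤ |Z n ω j|) ∧ ∀ j, |Z n ω j| ≤ b * supScale p n} := by
  have hS : MeasurableSet {x : Fin n → ℝ |
      (∃ j, a * supScale p n ≤ |x j|) ∧ ∀ j, |x j| ≤ b * supScale p n} := 
    (measurableSet_exists_le_abs n _).inter (measurableSet_forall_abs_le n _)
  have hn2 : 2 ≤ n := by omega
  have hp0 : 0 < p := by linarith
  have hv := volume_real_powerSumBall_one_pos hp (show 1 ≤ n by omega)
  have hn0 : (0 : ℝ) < n := by positivity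
  have hn4 : (4 : ℝ) ≤ n := by exact_mod_cast hn
  have hL := log_natCast_pos hn2
  have hexpL : exp (log (n : ℝ)) = n := Real.exp_log hn0
  have ht0 := supScale_pos hp hn2
  have hb : 0 ≤ b := ha.trans hab
  refine le_trans ?_ (prob_mem_eq hp hZmeas hZdist hS).ge
  rw [le_div_iff₀ hv]
  have hx0 : 0 ≤ b ^ p * (p * log n / n) := by positivity
  have hmain := le_volume_real_sup_between (n := n - 1) (t := a * supScale p n)
    (t' := b * supScale p n) hp (by positivity) (by gcongr)
    (by rw [mul_supScale_rpow hp hb hn2]; exact hx.le) (by omega)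
  have hratio := volume_real_powerSumBall_succ_le (n := n - 1) hp ht0.le (by omega)
  have hnn : n - 1 + 1 = n := by omega
  have hcast : ((n - 1 : ℕ) : ℝ) = n - 1 := by
    rw [Nat.cast_sub (by omega), Nat.cast_one]
  have ht1 : supScale p n ^ p = p * log n / n := by
    simpa using mul_supScale_rpow hp zero_le_one hn2
  rw [hnn, ht1] at hratio
  rw [hnn, hcast, mul_supScale_rpow hp hb hn2, mul_supScale_rpow hp ha hn2] at hmain
  refine le_trans ?_ hmain
  set v := volume.real (powerSumBall p 1 n) with hvdef
  set w := volume.real (powerSumBall p 1 (n - 1)) with hw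
  have hw0 : 0 ≤ w := measureReal_nonneg
  set x := b ^ p * (p * log n / n) with hxdef
  -- comparison of consecutive volumes
  have h1 : v ≤ 4 * supScale p n * w := by
    have h : exp (-(n * (p * log n / n) / p)) ≤ 1 / 4 := by
      rw [show (n : ℝ) * (p * log n / n) / p = log n by field_simp, Real.exp_neg, hexpL,
        ← one_div]
      exact one_div_le_one_div_of_le (by norm_num) hn4
    nlinarith
  -- the remaining coordinates are typically small
  have h2 : 1 / 2 ≤ 1 - 2 * ((n : ℝ) - 1) * exp (-((n - 1) * (a ^ p * (p * log n / n)) / p)) := by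
    have h3 : κ * log n ≤ (n - 1) * (a ^ p * (p * log n / n)) / p := by
      rw [show (n - 1) * (a ^ p * (p * log n / n)) / p = a ^ p * (n - 1) * (log n / n) by
        field_simp]
      calc κ * log n = κ * n * (log n / n) := by field_simp
        _ ≤ _ := by gcongr
    have h4 : n * exp (-((n - 1) * (a ^ p * (p * log n / n)) / p)) ≤
        exp (-((κ - 1) * log n)) := by
      nth_rw 1 [← hexpL]
      rw [← Real.exp_add, Real.exp_le_exp]
      linarith
    have h5 := exp_pos (-((n - 1) * (a ^ p * (p * log n / n)) / p))
    nlinarith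
  -- the radius of the slice
  have h3 : exp (-(β * log n)) ≤ (1 - x) ^ ((n - 1) / p) := by
    have hy : 0 < 1 - x := by linarith
    have h4 := Real.one_sub_inv_le_log_of_pos hy
    have h5 : (1 - x) ^ (n / p) ≤ (1 - x) ^ ((n - 1) / p) :=
      Real.rpow_le_rpow_of_exponent_ge hy (by linarith) (by gcongr; linarith)
    refine le_trans ?_ h5
    rw [Real.rpow_def_of_pos hy, Real.exp_le_exp]
    have h6 : 1 - (1 - x)⁻¹ = -(x / (1 - x)) := by field_simp; ring
    rw [h6] at h4
    have h7 : n / p * (x / (1 - x)) ≤ β * log n := by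
      have : n / p * (x / (1 - x)) = b ^ p / (1 - x) * log n := by
        rw [hxdef]; field_simp
      rw [this]
      gcongr
      rwa [div_le_iff₀ hy]
    have h8 : 0 < n / p := by positivity
    nlinarith
  have h4 : exp ((1 - β) * log n) = n * exp (-(β * log n)) := by
    nth_rw 2 [← hexpL]
    rw [← Real.exp_add]
    ring_nf
  have hba : 0 ≤ b - a := by linarith
  have hxx : 0 ≤ (1 - x) ^ ((n - 1) / p) := Real.rpow_nonneg (by linarith) _
  calc (b - a) / 8 * exp ((1 - β) * log n) * v
      ≤ (b - a) / 8 * exp ((1 - β) * log n) * (4 * supScale p n * w) := by gcongr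
    _ = n * ((b * supScale p n - a * supScale p n) * (1 / 2 * (exp (-(β * log n)) * w))) := by
        rw [h4]; ring
    _ ≤ _ := by
        have : 0 ≤ b * supScale p n - a * supScale p n := by
          rw [← sub_mul]; positivity
        rw [sub_add_cancel]
        gcongr

lemma tendsto_log_natCast_atTop : Tendsto (fun n : ℕ => log (n : ℝ)) atTop atTop :=
  Real.tendsto_log_atTop.comp tendsto_natCast_atTop_atTop

lemma eventually_prob_exists_tail_le (hp : 1 ≤ p) (hZmeas : ∀ n, Measurable (Z n))
    (hZdist : ∀ n : ℕ, Measure.map (Z n) ℙ = (volume : Measure (Fin n → ℝ))[|lpBall p n])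
    {z M : ℝ} (hz : 0 ≤ z) (hM : 1 - z ^ p < M) :
    ∀ᶠ n : ℕ in atTop, (ℙ : Measure Ω).real {ω | ∃ j, z * supScale p n ≤ |Z n ω j|} ≤
      exp (M * log n) := by
  have hlim : Tendsto (fun n : ℕ => (M - (1 - z ^ p)) * log n) atTop atTop :=
    tendsto_log_natCast_atTop.const_mul_atTop (by linarith)
  filter_upwards [eventually_ge_atTop 2, hlim.eventually_ge_atTop (log 2)] with n hn hlog
  refine (prob_exists_tail_le hp hZmeas hZdist hn hz).trans ?_
  have hn0 : (0 : ℝ) < n := by positivity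
  have h : 2 * n * exp (-(z ^ p * log n)) = exp (log 2 + log n - z ^ p * log n) := by
    rw [sub_eq_add_neg, Real.exp_add, Real.exp_add, Real.exp_log two_pos, Real.exp_log hn0]
  rw [h, Real.exp_le_exp]
  linarith

lemma eventually_prob_forall_le_le (hp : 1 ≤ p) (hZmeas : ∀ n, Measurable (Z n))
    (hZdist : ∀ n : ℕ, Measure.map (Z n) ℙ = (volume : Measure (Fin n → ℝ))[|lpBall p n])
    {z : ℝ} (hz : 0 ≤ z) (hz1 : z < 1) (M : ℝ) :
    ∀ᶠ n : ℕ in atTop, (ℙ : Measure Ω).real {ω | ∀ j, |Z n ω j| ≤ z * supScale p n} ≤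
      exp (M * log n) := by
  obtain ⟨z', hzz, hz'⟩ := exists_between hz1
  have hp0 : 0 < p := by linarith
  have hG : 0 < Gamma (1 / p + 1) := Real.Gamma_pos_of_pos (by positivity)
  set C := (z' - z) / (2 * Gamma (1 / p + 1)) with hC
  have hC0 : 0 < C := div_pos (by linarith) (by linarith)
  set κ := 1 - z' ^ p with hκ
  have hκ0 : 0 < κ := by
    have := Real.rpow_lt_one (hz.trans hzz.le) hz' hp0
    linarith
  have hlim : Tendsto (fun n : ℕ => C * κ ^ 2 / 2 * log n) atTop atTop :=
    tendsto_log_natCast_atTop.const_mul_atTop (by positivity)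
  filter_upwards [eventually_ge_atTop 2, hlim.eventually_ge_atTop (3 + |M|),
    tendsto_log_natCast_atTop.eventually_ge_atTop 1] with n hn hlog hL1
  refine (prob_forall_le_le hp hZmeas hZdist hn hz hzz.le).trans ?_
  have hn0 : (0 : ℝ) < n := by positivity
  have hn2 : (2 : ℝ) ≤ n := by exact_mod_cast hn
  have hexp : n * exp (-(z' ^ p * log n)) = exp (κ * log n) := by
    nth_rw 1 [← Real.exp_log hn0]
    rw [← Real.exp_add, hκ]
    ring_nf
  have h1 : n / p + 1 ≤ exp (1 + log n) := by
    rw [Real.exp_add, Real.exp_log hn0]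
    have : (n : ℝ) / p ≤ n := div_le_self hn0.le hp
    nlinarith [Real.add_one_le_exp (1 : ℝ)]
  have h2 : C * exp (κ * log n) ≤ C * (log n) ^ (1 / p) * exp (κ * log n) := by
    have := Real.one_le_rpow hL1 (z := 1 / p) (by positivity)
    gcongr
    nlinarith
  have h3 : (3 + |M|) * log n ≤ C * exp (κ * log n) := by
    have h4 : 0 ≤ κ * log n := by positivity
    have h5 : (κ * log n) ^ 2 / 2 ≤ exp (κ * log n) := by
      linarith [Real.quadratic_le_exp_of_nonneg h4]
    calc (3 + |M|) * log n ≤ C * κ ^ 2 / 2 * log n * log n := by gcongr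
      _ = C * ((κ * log n) ^ 2 / 2) := by ring
      _ ≤ _ := by gcongr
  have h6 : -M * log n ≤ |M| * log n := by
    gcongr
    exact neg_le_abs M
  rw [hexp]
  calc _ ≤ exp (1 + log n) * exp 1 * exp (-(C * (log n) ^ (1 / p) * exp (κ * log n))) := by gcongr
    _ = exp (1 + log n + 1 + -(C * (log n) ^ (1 / p) * exp (κ * log n))) := by
      rw [← Real.exp_add, ← Real.exp_add]
    _ ≤ _ := by
      rw [Real.exp_le_exp]
      nlinarith

lemma eventually_le_prob_between (hp : 1 ≤ p) (hZmeas : ∀ n, Measurable (Z n))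
    (hZdist : ∀ n : ℕ, Measure.map (Z n) ℙ = (volume : Measure (Fin n → ℝ))[|lpBall p n])
    {a b M : ℝ} (ha : 1 < a) (hab : a < b) (hM : M < 1 - b ^ p) :
    ∀ᶠ n : ℕ in atTop, exp (M * log n) ≤ (ℙ : Measure Ω).real
      {ω | (∃ j, a * supScale p n ≤ |Z n ω j|) ∧ ∀ j, |Z n ω j| ≤ b * supScale p n} := by
  have hap : 1 < a ^ p := Real.one_lt_rpow ha (by linarith)
  obtain ⟨κ, hκ1, hκ⟩ := exists_between hap
  obtain ⟨β, hβ, hβM⟩ := exists_between (show b ^ p < 1 - M by linarith)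
  have hlog := tendsto_log_natCast_atTop
  have hlim1 : Tendsto (fun n : ℕ => (a ^ p - κ) * (n : ℝ)) atTop atTop :=
    tendsto_natCast_atTop_atTop.const_mul_atTop (by linarith)
  have hlim2 : Tendsto (fun n : ℕ => (κ - 1) * log n) atTop atTop :=
    hlog.const_mul_atTop (by linarith)
  have hlim3 : Tendsto (fun n : ℕ => (1 - β - M) * log n) atTop atTop :=
    hlog.const_mul_atTop (by linarith)
  have hlim4 : Tendsto (fun n : ℕ => b ^ p * (p * log n / n)) atTop (𝓝 0) := by
    have h : Tendsto (fun n : ℕ => log (n : ℝ) / n) atTop (𝓝 0) :=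
      Real.isLittleO_log_id_atTop.tendsto_div_nhds_zero.comp tendsto_natCast_atTop_atTop
    simpa [mul_div_assoc] using (h.const_mul p).const_mul (b ^ p)
  have hlim5 : Tendsto (fun n : ℕ => β * (1 - b ^ p * (p * log n / n))) atTop (𝓝 β) := by
    simpa using (hlim4.const_sub 1).const_mul β
  filter_upwards [eventually_ge_atTop 4, hlim1.eventually_ge_atTop (a ^ p),
    hlim2.eventually_ge_atTop (log 4), hlim3.eventually_ge_atTop (-log ((b - a) / 8)),
    hlim4.eventually_lt_const one_pos, hlim5.eventually_const_le hβ] with n hn h1 h2 h3 h4 h5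
  refine le_trans ?_ (le_prob_between hp hZmeas hZdist hn (by linarith) hab.le (κ := κ) (β := β)
    (by linarith) ?_ h4 h5)
  · have hba : 0 < (b - a) / 8 := by linarith
    rw [← Real.exp_log hba, ← Real.exp_add, Real.exp_le_exp]
    linarith
  · rw [← Real.exp_log (show (0 : ℝ) < 4 by norm_num), ← Real.exp_add, Real.exp_le_one_iff]
    linarith

end Probability

lemma inv_mul_log_le_of_le_exp {μ : ENNReal} {L M : ℝ} (hL : 0 < L) (hμ : μ ≠ ⊤)
    (h : μ.toReal ≤ exp (M * L)) : ((L⁻¹ : ℝ) : EReal) * ENNReal.log μ ≤ (M : EReal) := by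
  have h1 : ENNReal.log μ ≤ ((M * L : ℝ) : EReal) := by
    rw [← Real.log_exp (M * L), ← ENNReal.log_ofReal_of_pos (exp_pos _), ENNReal.log_le_log_iff]
    exact ENNReal.le_ofReal_iff_toReal_le hμ (exp_pos _).le |>.mpr h
  calc _ ≤ ((L⁻¹ : ℝ) : EReal) * ((M * L : ℝ) : EReal) :=
        mul_le_mul_of_nonneg_left h1 (by exact_mod_cast (inv_pos.mpr hL).le)
    _ = (M : EReal) := by
        rw [← EReal.coe_mul]
        congr 1
        field_simp

lemma le_inv_mul_log_of_exp_le {μ : ENNReal} {L M : ℝ} (hL : 0 < L) (hμ : μ ≠ ⊤)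
    (h : exp (M * L) ≤ μ.toReal) : (M : EReal) ≤ ((L⁻¹ : ℝ) : EReal) * ENNReal.log μ := by
  have h1 : ((M * L : ℝ) : EReal) ≤ ENNReal.log μ := by
    rw [← Real.log_exp (M * L), ← ENNReal.log_ofReal_of_pos (exp_pos _), ENNReal.log_le_log_iff]
    exact ENNReal.ofReal_le_iff_le_toReal hμ |>.mpr h
  calc (M : EReal) = ((L⁻¹ : ℝ) : EReal) * ((M * L : ℝ) : EReal) := by
        rw [← EReal.coe_mul]
        congr 1
        field_simp
    _ ≤ _ := mul_le_mul_of_nonneg_left h1 (by exact_mod_cast (inv_pos.mpr hL).le)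

lemma exists_le_abs_of_le_iSup {n : ℕ} (hn : 1 ≤ n) {x : Fin n → ℝ} {t : ℝ}
    (h : t ≤ ⨆ i, |x i|) : ∃ j, t ≤ |x j| := by
  have : Nonempty (Fin n) := ⟨⟨0, hn⟩⟩
  obtain ⟨j, hj⟩ := exists_eq_ciSup_of_finite (f := fun i => |x i|)
  exact ⟨j, h.trans_eq hj.symm⟩

lemma abs_le_iSup_abs {n : ℕ} (x : Fin n → ℝ) (j : Fin n) : |x j| ≤ ⨆ i, |x i| :=
  le_ciSup (f := fun i => |x i|) (Set.finite_range _).bddAbove j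

/-- **LDP for the `ℓ_∞`-norm of uniform random points in the `ℓ_p^n`-ball.**
If `Z_n` is uniformly distributed in `𝔹_p^n`, then `X_n = (n/(p log n))^{1/p} ‖Z_n‖_∞`
satisfies an LDP with speed `log n` and rate function `I(z) = z^p - 1` for `z ≥ 1`,
`I(z) = +∞` for `z < 1`. -/
theorem ldp_lp_ball_supnorm
    {Ω : Type*} [MeasureSpace Ω] [IsProbabilityMeasure (ℙ : Measure Ω)]
    (p : ℝ) (hp : 1 ≤ p)
    (Z : (n : ℕ) → Ω → (Fin n → ℝ)) (hZmeas : ∀ n, Measurable (Z n))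
    (hZdist : ∀ n : ℕ, Measure.map (Z n) ℙ = (volume : Measure (Fin n → ℝ))[|lpBall p n]) :
    ∀ A : Set ℝ, MeasurableSet A →
      (-⨅ z ∈ interior A, lpRate p z) ≤
          liminf (fun n : ℕ =>
            (((Real.log n)⁻¹ : ℝ) : EReal) *
              ENNReal.log (ℙ {ω |
                ((n : ℝ) / (p * Real.log n)) ^ (1 / p) * (⨆ i : Fin n, |Z n ω i|) ∈ A})) atTop ∧
        limsup (fun n : ℕ =>
            (((Real.log n)⁻¹ : ℝ) : EReal) *
              ENNReal.log (ℙ {ω |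
                ((n : ℝ) / (p * Real.log n)) ^ (1 / p) * (⨆ i : Fin n, |Z n ω i|) ∈ A})) atTop ≤
          -⨅ z ∈ closure A, lpRate p z := by
  intro A _
  have hp0 : 0 < p := by linarith
  constructor
  · rw [← EReal.ge_of_forall_gt_iff_ge]
    intro M hM
    refine le_liminf_of_le (h := ?_)
    rw [EReal.lt_neg_comm] at hM
    simp only [iInf_lt_iff, exists_prop] at hM
    obtain ⟨z, hz, hzM⟩ := hM
    have hz1 : 1 ≤ z := by
      by_contra h
      simp [lpRate, h] at hzM
    rw [lpRate, if_pos hz1, ← EReal.coe_neg, EReal.coe_lt_coe_iff] at hzM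
    have hcont : ContinuousAt (fun y : ℝ => y ^ p - 1) z :=
      (Real.continuousAt_rpow_const z p (Or.inr hp0.le)).sub_const 1
    have hev : ∀ᶠ y in 𝓝 z, y ∈ interior A ∧ y ^ p - 1 < -M :=
      Filter.Eventually.and (isOpen_interior.mem_nhds hz) (hcont.eventually_lt_const hzM)
    obtain ⟨ε, hε, hball⟩ := Metric.eventually_nhds_iff.mp hev
    have hb : (z + ε / 2) ^ p - 1 < -M := (hball (by
      rw [Real.dist_eq, add_sub_cancel_left, abs_of_pos] <;> linarith)).2
    filter_upwards [eventually_ge_atTop 2, eventually_le_prob_between hp hZmeas hZdist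
      (a := z + ε / 4) (b := z + ε / 2) (M := M) (by linarith) (by linarith) (by linarith)]
      with n hn h
    refine le_inv_mul_log_of_exp_le (log_natCast_pos hn) (measure_ne_top _ _) (h.trans ?_)
    refine measureReal_mono ?_
    rintro ω ⟨⟨j, hj⟩, hle⟩
    have : Nonempty (Fin n) := ⟨j⟩
    have ht := supScale_pos hp hn
    have h1 := hj.trans (abs_le_iSup_abs (Z n ω) j)
    have h2 : (⨆ i, |Z n ω i|) ≤ (z + ε / 2) * supScale p n := ciSup_le hle
    rw [Set.mem_ofPred_eq, div_rpow_eq_inv_supScale hp hn]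
    refine interior_subset (hball ?_).1
    rw [inv_mul_eq_div]
    rw [← le_div_iff₀ ht] at h1
    rw [← div_le_iff₀ ht] at h2
    rw [Real.dist_eq, abs_lt]
    constructor <;> linarith
  · rw [← EReal.le_of_forall_lt_iff_le]
    intro M hM
    refine limsup_le_of_le (h := ?_)
    rcases le_or_gt 0 M with hM0 | hM0
    · filter_upwards [eventually_ge_atTop 2] with n hn
      have hL := log_natCast_pos hn
      refine inv_mul_log_le_of_le_exp hL (measure_ne_top _ _) ?_
      exact (measureReal_le_one (μ := ℙ)).trans (Real.one_le_exp (by positivity))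
    obtain ⟨M', hM', hMM⟩ := EReal.lt_iff_exists_real_btwn.mp hM
    rw [EReal.coe_lt_coe_iff] at hMM
    have hrate (z : ℝ) (hz : z ∈ closure A) : ((-M' : ℝ) : EReal) < lpRate p z := by
      rw [EReal.coe_neg]
      exact (EReal.neg_lt_comm.mp hM').trans_le (iInf₂_le z hz)
    have hone : (1 : ℝ) ∉ closure A := by
      intro h
      have := hrate 1 h
      rw [lpRate, if_pos le_rfl, EReal.coe_lt_coe_iff, Real.one_rpow] at this
      linarith
    have hev : ∀ᶠ y in 𝓝 (1 : ℝ), y ∉ closure A :=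
      isClosed_closure.isOpen_compl.mem_nhds hone
    obtain ⟨ε, hε, hball⟩ := Metric.eventually_nhds_iff.mp hev
    set z₀ := max (1 - ε) 0 with hz₀
    have hz₀1 : z₀ < 1 := max_lt (by linarith) one_pos
    set z₁ := (1 - M') ^ (1 / p) with hz₁
    have hz₁0 : 0 ≤ z₁ := Real.rpow_nonneg (by linarith) _
    have hz₁p : z₁ ^ p = 1 - M' := by
      rw [hz₁, ← Real.rpow_mul (by linarith), one_div_mul_cancel hp0.ne', Real.rpow_one]
    obtain ⟨N, hMN, hNM⟩ := exists_between hMM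
    have hlim : Tendsto (fun n : ℕ => (M - N) * log n) atTop atTop :=
      tendsto_log_natCast_atTop.const_mul_atTop (by linarith)
    filter_upwards [eventually_ge_atTop 2, hlim.eventually_ge_atTop (log 2),
      eventually_prob_exists_tail_le hp hZmeas hZdist (M := N) hz₁0 (by linarith),
      eventually_prob_forall_le_le hp hZmeas hZdist (le_max_right _ _) hz₀1 N]
      with n hn hlog h1 h2
    have hL := log_natCast_pos hn
    refine inv_mul_log_le_of_le_exp hL (measure_ne_top _ _) ?_
    have hsub : {ω | ((n : ℝ) / (p * Real.log n)) ^ (1 / p) * (⨆ i : Fin n, |Z n ω i|) ∈ A} ⊆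
        {ω | ∃ j, z₁ * supScale p n ≤ |Z n ω j|} ∪
        {ω | ∀ j, |Z n ω j| ≤ z₀ * supScale p n} := by
      intro ω hω
      have ht := supScale_pos hp hn
      rw [Set.mem_ofPred_eq, div_rpow_eq_inv_supScale hp hn, inv_mul_eq_div] at hω
      set y := (⨆ i, |Z n ω i|) / supScale p n with hy
      have hyc : y ∈ closure A := subset_closure hω
      rcases le_or_gt 1 y with h | h
      · left
        have hr := hrate y hyc
        rw [lpRate, if_pos h, EReal.coe_lt_coe_iff] at hr
        have : z₁ ≤ y := by
          rw [← Real.rpow_le_rpow_iff hz₁0 (by linarith) hp0]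
          linarith
        rw [hy, le_div_iff₀ ht] at this
        exact exists_le_abs_of_le_iSup (by omega) this
      · right
        have : y ≤ z₀ := by
          by_contra! hlt
          refine hball ?_ hyc
          have := (le_max_left (1 - ε) 0).trans_lt hlt
          rw [Real.dist_eq, abs_lt]
          constructor <;> linarith
        rw [hy, div_le_iff₀ ht] at this
        exact fun j => (abs_le_iSup_abs (Z n ω) j).trans this
    calc _ ≤ _ := measureReal_mono (μ := ℙ) hsub
      _ ≤ _ := measureReal_union_le _ _
      _ ≤ exp (N * log n) + exp (N * log n) := add_le_add h1 h2
      _ = exp (log 2 + N * log n) := by rw [Real.exp_add, Real.exp_log two_pos]; ring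
      _ ≤ _ := by rw [Real.exp_le_exp]; linarith
end

section
/- For all p with 1 ≤ p < ∞ and all x > 0, (x/(x^p + p)) e^{−x^p/p} ≤ ∫_x^∞ e^{−y^p/p} dy ≤ x^{−(p−1)} e^{−x^p/p}. -/
open MeasureTheory Real

theorem hasDerivAt_exp_neg_rpow_div {p y : ℝ} (hp : p ≠ 0) (hy : 0 < y) :
    HasDerivAt (fun z : ℝ => Real.exp (-(z ^ p) / p))
      (-(Real.exp (-(y ^ p) / p) * y ^ (p - 1))) y := by
  refine ((Real.hasDerivAt_rpow_const (p := p) (Or.inl hy.ne')).fun_neg.div_const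
    p).exp.congr_deriv ?_
  field_simp

theorem tendsto_exp_neg_rpow_div_atTop {p : ℝ} (hp : 0 < p) :
    Filter.Tendsto (fun y : ℝ => Real.exp (-(y ^ p) / p)) Filter.atTop (nhds 0) := by
  simp only [neg_div]
  exact Real.tendsto_exp_neg_atTop_nhds_zero.comp
    ((tendsto_rpow_atTop hp).atTop_div_const hp)

theorem tendsto_mul_exp_neg_rpow_div_atTop {p : ℝ} (hp : 0 < p) {c : ℝ → ℝ}
    (hc : ∀ y, 1 ≤ y → 0 ≤ c y ∧ c y ≤ 1) :
    Filter.Tendsto (fun y : ℝ => c y * Real.exp (-(y ^ p) / p)) Filter.atTop (nhds 0) := by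
  refine tendsto_of_tendsto_of_tendsto_of_le_of_le' tendsto_const_nhds
    (tendsto_exp_neg_rpow_div_atTop hp) ?_ ?_
  · filter_upwards [Filter.eventually_ge_atTop 1] with y hy
    exact mul_nonneg (hc y hy).1 (Real.exp_pos _).le
  · filter_upwards [Filter.eventually_ge_atTop 1] with y hy
    exact mul_le_of_le_one_left (Real.exp_pos _).le (hc y hy).2

/-- The antiderivative behind the upper tail bound. -/
theorem hasDerivAt_neg_rpow_mul_exp {p y : ℝ} (hp : p ≠ 0) (hy : 0 < y) :
    HasDerivAt (fun z : ℝ => -(z ^ (-(p - 1)) * Real.exp (-(z ^ p) / p)))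
      ((1 + (p - 1) * y ^ (-p)) * Real.exp (-(y ^ p) / p)) y := by
  refine ((Real.hasDerivAt_rpow_const (p := -(p - 1)) (Or.inl hy.ne')).fun_mul
    (hasDerivAt_exp_neg_rpow_div hp hy)).fun_neg.congr_deriv ?_
  have h : y ^ (-(p - 1)) * y ^ (p - 1) = 1 := by
    rw [← Real.rpow_add hy, neg_add_cancel, Real.rpow_zero]
  rw [show -(p - 1) - 1 = -p by ring]
  linear_combination Real.exp (-(y ^ p) / p) * h

/-- The antiderivative behind the lower tail bound. -/
theorem hasDerivAt_neg_div_mul_exp {p y : ℝ} (hp : 0 < p) (hy : 0 < y) :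
    HasDerivAt (fun z : ℝ => -(z / (z ^ p + p) * Real.exp (-(z ^ p) / p)))
      (((y ^ p) ^ 2 + 2 * p * y ^ p - y ^ p - p) / (y ^ p + p) ^ 2 *
        Real.exp (-(y ^ p) / p)) y := by
  have hd : y ^ p + p ≠ 0 := (add_pos (Real.rpow_pos_of_pos hy p) hp).ne'
  refine (((hasDerivAt_id' y).fun_div
    ((Real.hasDerivAt_rpow_const (p := p) (Or.inl hy.ne')).add_const p) hd).fun_mul
    (hasDerivAt_exp_neg_rpow_div hp.ne' hy)).fun_neg.congr_deriv ?_
  have h : y ^ p = y * y ^ (p - 1) := by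
    rw [Real.rpow_sub_one hy.ne']
    field_simp
  rw [h] at hd ⊢
  field_simp
  ring

theorem p_gaussian_tail_integrable_and_le {p : ℝ} (hp : 1 ≤ p) {x : ℝ} (hx : 0 < x) :
    IntegrableOn (fun y : ℝ => Real.exp (-(y ^ p) / p)) (Set.Ioi x) ∧
      ∫ y in Set.Ioi x, Real.exp (-(y ^ p) / p) ≤
        x ^ (-(p - 1)) * Real.exp (-(x ^ p) / p) := by
  have hp0 : 0 < p := by linarith
  have hderiv : ∀ y ∈ Set.Ici x, HasDerivAt _ _ y := fun y hy =>
    hasDerivAt_neg_rpow_mul_exp hp0.ne' (hx.trans_le hy)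
  have hcoef : ∀ y ∈ Set.Ioi x, 0 ≤ (p - 1) * y ^ (-p) := fun y hy =>
    mul_nonneg (by linarith) (Real.rpow_nonneg (hx.trans hy).le _)
  have hnonneg : ∀ y ∈ Set.Ioi x,
      0 ≤ (1 + (p - 1) * y ^ (-p)) * Real.exp (-(y ^ p) / p) := fun y hy =>
    mul_nonneg (by linarith [hcoef y hy]) (Real.exp_pos _).le
  have hle : ∀ y ∈ Set.Ioi x, Real.exp (-(y ^ p) / p) ≤
      (1 + (p - 1) * y ^ (-p)) * Real.exp (-(y ^ p) / p) := fun y hy =>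
    le_mul_of_one_le_left (Real.exp_pos _).le (by linarith [hcoef y hy])
  have hlim := (tendsto_mul_exp_neg_rpow_div_atTop hp0 (c := fun y => y ^ (-(p - 1)))
    fun y hy => ⟨Real.rpow_nonneg (by linarith) _,
      Real.rpow_le_one_of_one_le_of_nonpos hy (by linarith)⟩).neg
  have hint := integrableOn_Ioi_deriv_of_nonneg' hderiv hnonneg hlim
  have hint' : IntegrableOn (fun y : ℝ => Real.exp (-(y ^ p) / p)) (Set.Ioi x) := by
    refine Integrable.mono' hint (by fun_prop) ?_
    filter_upwards [ae_restrict_mem measurableSet_Ioi] with y hy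
    rw [Real.norm_of_nonneg (Real.exp_pos _).le]
    exact hle y hy
  refine ⟨hint', (setIntegral_mono_on hint' hint measurableSet_Ioi hle).trans_eq ?_⟩
  rw [integral_Ioi_of_hasDerivAt_of_nonneg' hderiv hnonneg hlim]
  ring

theorem le_p_gaussian_tail {p : ℝ} (hp : 1 ≤ p) {x : ℝ} (hx : 0 < x) :
    x / (x ^ p + p) * Real.exp (-(x ^ p) / p) ≤
      ∫ y in Set.Ioi x, Real.exp (-(y ^ p) / p) := by
  have hp0 : 0 < p := by linarith
  have hint := (p_gaussian_tail_integrable_and_le hp hx).1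
  have hderiv : ∀ y ∈ Set.Ici x, HasDerivAt _ _ y := fun y hy =>
    hasDerivAt_neg_div_mul_exp hp0 (hx.trans_le hy)
  have hcoef : ∀ y ∈ Set.Ioi x,
      |((y ^ p) ^ 2 + 2 * p * y ^ p - y ^ p - p) / (y ^ p + p) ^ 2| ≤ 1 := by
    intro y hy
    have ht : 0 < y ^ p := Real.rpow_pos_of_pos (hx.trans hy) p
    have hd : 0 < (y ^ p + p) ^ 2 := by positivity
    rw [abs_le, le_div_iff₀ hd, div_le_one hd]
    constructor <;> nlinarith [mul_pos hp0 ht]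
  have hlim := (tendsto_mul_exp_neg_rpow_div_atTop hp0 (c := fun y => y / (y ^ p + p))
    fun y hy => by
      have hyp : y ≤ y ^ p := Real.self_le_rpow_of_one_le hy hp
      exact ⟨div_nonneg (by linarith) (by linarith),
        (div_le_one (by linarith)).2 (by linarith)⟩).neg
  have hint' : IntegrableOn (fun y : ℝ =>
      ((y ^ p) ^ 2 + 2 * p * y ^ p - y ^ p - p) / (y ^ p + p) ^ 2 *
        Real.exp (-(y ^ p) / p)) (Set.Ioi x) := by
    refine Integrable.mono' hint (Measurable.aestronglyMeasurable (by fun_prop)) ?_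
    filter_upwards [ae_restrict_mem measurableSet_Ioi] with y hy
    rw [norm_mul, Real.norm_of_nonneg (Real.exp_pos _).le]
    exact mul_le_of_le_one_left (Real.exp_pos _).le (hcoef y hy)
  have hmono := setIntegral_mono_on hint' hint measurableSet_Ioi fun y hy =>
    mul_le_of_le_one_left (Real.exp_pos _).le (abs_le.1 (hcoef y hy)).2
  rw [integral_Ioi_of_hasDerivAt_of_tendsto' hderiv hint' hlim] at hmono
  linarith

/-- **Tail bounds for the `p`-generalized Gaussian integral.**
For all `1 ≤ p < ∞` and `x > 0`,
`(x/(x^p + p)) e^{-x^p/p} ≤ ∫_x^∞ e^{-y^p/p} dy ≤ x^{-(p-1)} e^{-x^p/p}`. -/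
theorem p_gaussian_tail_bounds (p : ℝ) (hp : 1 ≤ p) (x : ℝ) (hx : 0 < x) :
    x / (x ^ p + p) * Real.exp (-(x ^ p) / p) ≤
        (∫ y in Set.Ici x, Real.exp (-(y ^ p) / p)) ∧
      (∫ y in Set.Ici x, Real.exp (-(y ^ p) / p)) ≤
        x ^ (-(p - 1)) * Real.exp (-(x ^ p) / p) := by
  rw [integral_Ici_eq_integral_Ioi]
  exact ⟨le_p_gaussian_tail hp hx, (p_gaussian_tail_integrable_and_le hp hx).2⟩
end

section
/- Let (X_n)_{n∈ℕ} be real-valued random variables satisfying a large deviations principle with positive speed (s_n) and lower semicontinuous rate function I : ℝ → [0, ∞] with compact level sets (i.e., for every Borel set A ⊆ ℝ, −inf_{z ∈ A°} I(z) ≤ liminf_{n→∞} s_n^{−1} log P[X_n ∈ A] and limsup_{n→∞} s_n^{−1} log P[X_n ∈ A] ≤ −inf_{z ∈ closure(A)} I(z)), and assume I(x) → ∞ as x → +∞ and as x → −∞. If (a_n)_{n∈ℕ} is a real sequence with a_n → 1, then the sequence (a_n X_n)_{n∈ℕ} satisfies the large deviations principle with the same speed s_n and the same rate function I. -/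
open MeasureTheory ProbabilityTheory Filter Topology Real

/-- Multiplication by `a n → 1` is eventually uniformly close to the identity on bounded sets. -/
lemma eventually_dist_mul_lt_of_tendsto_one {a : ℕ → ℝ} (ha : Tendsto a atTop (𝓝 1))
    {V : Set ℝ} (hV : Bornology.IsBounded V) {δ : ℝ} (hδ : 0 < δ) :
    ∀ᶠ n in atTop, ∀ x ∈ V, dist (a n * x) x < δ := by
  obtain ⟨R, hR, hVR⟩ := hV.exists_pos_norm_le
  filter_upwards [Metric.tendsto_nhds.1 ha (δ / R) (by positivity)] with n hn x hx
  have hfactor : a n * x - x = (a n - 1) * x := by ring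
  rw [Real.dist_eq] at hn ⊢
  rw [hfactor, abs_mul]
  calc |a n - 1| * |x| ≤ |a n - 1| * R := by gcongr; exact hVR x hx
    _ < δ := (lt_div_iff₀ hR).1 hn

lemma inv_mul_log_measure_mono {Ω : Type*} [MeasurableSpace Ω] (μ : Measure Ω) {s : ℝ}
    (hs : 0 < s) {E F : Set Ω} (h : E ⊆ F) :
    ((s⁻¹ : ℝ) : EReal) * ENNReal.log (μ E) ≤ ((s⁻¹ : ℝ) : EReal) * ENNReal.log (μ F) :=
  mul_le_mul_of_nonneg_left (ENNReal.log_monotone (measure_mono h))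
    (EReal.coe_nonneg.2 (inv_nonneg.2 hs.le))

/-- **Stability of an LDP under multiplication by a sequence converging to one.**
If `(X_n)` satisfies an LDP with positive speed `s_n` and good rate function `I` tending to
`∞` at `±∞`, and `a_n → 1`, then `(a_n X_n)` satisfies the LDP with the same speed and rate. -/
theorem ldp_mul_of_tendsto_one
    {Ω : Type*} [MeasureSpace Ω] [IsProbabilityMeasure (ℙ : Measure Ω)]
    (X : ℕ → Ω → ℝ) (hXmeas : ∀ n, Measurable (X n))
    (s : ℕ → ℝ) (hs_pos : ∀ n, 0 < s n)
    (I : ℝ → EReal) (hI_nonneg : ∀ z, 0 ≤ I z)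
    (hI_lsc : LowerSemicontinuous I)
    (hI_compact : ∀ α : ℝ, IsCompact {z : ℝ | I z ≤ (α : EReal)})
    (hI_top : Tendsto I atTop (𝓝 ⊤)) (hI_bot : Tendsto I atBot (𝓝 ⊤))
    (hLDP : ∀ A : Set ℝ, MeasurableSet A →
      (-⨅ z ∈ interior A, I z) ≤
          Filter.liminf (fun n : ℕ =>
            (((s n)⁻¹ : ℝ) : EReal) * ENNReal.log (ℙ {ω | X n ω ∈ A})) atTop ∧
        Filter.limsup (fun n : ℕ =>
            (((s n)⁻¹ : ℝ) : EReal) * ENNReal.log (ℙ {ω | X n ω ∈ A})) atTop ≤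
          -⨅ z ∈ closure A, I z)
    (a : ℕ → ℝ) (ha : Tendsto a atTop (𝓝 1)) :
    ∀ A : Set ℝ, MeasurableSet A →
      (-⨅ z ∈ interior A, I z) ≤
          Filter.liminf (fun n : ℕ =>
            (((s n)⁻¹ : ℝ) : EReal) * ENNReal.log (ℙ {ω | a n * X n ω ∈ A})) atTop ∧
        Filter.limsup (fun n : ℕ =>
            (((s n)⁻¹ : ℝ) : EReal) * ENNReal.log (ℙ {ω | a n * X n ω ∈ A})) atTop ≤
          -⨅ z ∈ closure A, I z := by
  intro A _
  constructor
  · rw [EReal.neg_le]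
    refine le_iInf₂ fun z hz => ?_
    rw [EReal.neg_le]
    obtain ⟨ε, hε, hεA⟩ := Metric.isOpen_iff.1 isOpen_interior z hz
    have hball := (hLDP (Metric.ball z (ε / 2)) Metric.isOpen_ball.measurableSet).1
    rw [Metric.isOpen_ball.interior_eq] at hball
    have hI : -I z ≤ -⨅ y ∈ Metric.ball z (ε / 2), I y :=
      EReal.neg_le_neg_iff.2 (iInf₂_le z (Metric.mem_ball_self (half_pos hε)))
    refine (hI.trans hball).trans (liminf_le_liminf ?_)
    filter_upwards [eventually_dist_mul_lt_of_tendsto_one ha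
      (Metric.isBounded_ball (x := z) (r := ε / 2)) (half_pos hε)] with n hn
    refine inv_mul_log_measure_mono ℙ (hs_pos n) fun ω hω =>
      show a n * X n ω ∈ A from interior_subset (hεA ?_)
    have hX : dist (X n ω) z < ε / 2 := hω
    have htri := dist_triangle (a n * X n ω) (X n ω) z
    have hclose := hn (X n ω) hω
    exact Metric.mem_ball.2 (by linarith)
  · rw [EReal.le_neg]
    refine le_of_forall_lt fun c hc => ?_
    suffices h : ∀ c : ℝ, (c : EReal) < ⨅ z ∈ closure A, I z → limsup (fun n : ℕ =>
        (((s n)⁻¹ : ℝ) : EReal) * ENNReal.log (ℙ {ω | a n * X n ω ∈ A})) atTop ≤ -(c : EReal) by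
      obtain ⟨d, hcd, hd⟩ := EReal.lt_iff_exists_real_btwn.1 hc
      exact hcd.trans_le (EReal.le_neg.1 (h d hd))
    intro c hc
    have hdisj : Disjoint {z : ℝ | I z ≤ (c : EReal)} (closure A) :=
      Set.disjoint_left.2 fun z hz hzA => (hc.trans_le (iInf₂_le z hzA)).not_ge hz
    obtain ⟨δ, hδ, hthick⟩ := hdisj.exists_thickenings (hI_compact c) isClosed_closure
    set U := Metric.thickening δ {z : ℝ | I z ≤ (c : EReal)}
    have hU : IsOpen U := Metric.isOpen_thickening
    have hbound := (hLDP Uᶜ hU.measurableSet.compl).2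
    rw [hU.isClosed_compl.closure_eq] at hbound
    have hI : (c : EReal) ≤ ⨅ z ∈ Uᶜ, I z :=
      le_iInf₂ fun z hz => (not_le.1 fun hzc => hz (Metric.self_subset_thickening hδ _ hzc)).le
    refine le_trans (limsup_le_limsup ?_) (hbound.trans (EReal.neg_le_neg_iff.2 hI))
    filter_upwards [eventually_dist_mul_lt_of_tendsto_one ha
      ((hI_compact c).isBounded.thickening (δ := δ)) hδ] with n hn
    refine inv_mul_log_measure_mono ℙ (hs_pos n) fun ω hω hωU => ?_
    refine Set.disjoint_left.1 hthick hωU (Metric.mem_thickening_iff.2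
      ⟨a n * X n ω, subset_closure hω, ?_⟩)
    rw [dist_comm]
    exact hn _ hωU
end
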